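/- arXiv:math/0211424 — 2 statements merged into one kernel-verified Lean document; each statement's English description precedes it below -/
import Mathlib

section
/- Let λ₁, λ₂, λ₃, λ₄ ∈ [0, π]. The identity matrix I belongs to the set product C(λ₁)C(λ₂)C(λ₃)C(λ₄) in SU(2) if and only if every sum ±λ₁ ± λ₂ ± λ₃ ± λ₄ with exactly one minus sign is ≤ 2π and every sum ±λ₁ ± λ₂ ± λ₃ ± λ₄ with exactly three minus signs is ≤ 0. -/
open Matrix Complex Pointwise

/-- `SU(2)`: the subgroup of the unitary group `U(2)` (2×2 complex unitary matrices)
consisting of the matrices of determinant 1. -/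
noncomputable def SU2 : Subgroup (Matrix.unitaryGroup (Fin 2) ℂ) :=
  MonoidHom.ker (Matrix.detMonoidHom.comp (Submonoid.subtype _))

theorem mem_SU2_iff (A : Matrix.unitaryGroup (Fin 2) ℂ) :
    A ∈ SU2 ↔ Matrix.det (A : Matrix (Fin 2) (Fin 2) ℂ) = 1 := Iff.rfl

/-- The diagonal matrix `diag(e^{iλ}, e^{-iλ})` as an element of `SU(2)`. -/
noncomputable def su2diag (l : ℝ) : SU2 :=
  ⟨⟨Matrix.diagonal ![Complex.exp (l * Complex.I), Complex.exp (-(l * Complex.I))], by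
    rw [Matrix.mem_unitaryGroup_iff]
    rw [Matrix.star_eq_conjTranspose, Matrix.diagonal_conjTranspose,
      Matrix.diagonal_mul_diagonal]
    have h : (fun i => ![Complex.exp (l * Complex.I), Complex.exp (-(l * Complex.I))] i *
        star ![Complex.exp (l * Complex.I), Complex.exp (-(l * Complex.I))] i)
        = (1 : Fin 2 → ℂ) := by
      funext i
      fin_cases i <;>
        simp [Pi.star_apply, ← Complex.exp_conj, ← Complex.exp_add]
    rw [h]; exact Matrix.diagonal_one⟩, by
    rw [mem_SU2_iff]
    rw [Matrix.det_diagonal]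
    simp [Fin.prod_univ_two, ← Complex.exp_add]⟩

/-- The conjugacy class `C(λ)` of `diag(e^{iλ}, e^{-iλ})` in `SU(2)`. -/
noncomputable def conjClass (l : ℝ) : Set SU2 :=
  { g | ∃ h : SU2, h * su2diag l * h⁻¹ = g }

/-- The pointwise set product `C(λ₁)⋯C(λ_m)` of the conjugacy classes
`C(λ₁), …, C(λ_m)` in `SU(2)`. -/
noncomputable def classProd {m : ℕ} (l : Fin m → ℝ) : Set SU2 :=
  (List.ofFn fun i => conjClass (l i)).prod

theorem su2_ext {g h : SU2} (H : ((g : Matrix.unitaryGroup (Fin 2) ℂ) : Matrix (Fin 2) (Fin 2) ℂ)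
    = ((h : Matrix.unitaryGroup (Fin 2) ℂ) : Matrix (Fin 2) (Fin 2) ℂ)) : g = h :=
  Subtype.ext (Subtype.ext H)

/-- underlying matrix -/
def su2M (g : SU2) : Matrix (Fin 2) (Fin 2) ℂ := ((g : Matrix.unitaryGroup (Fin 2) ℂ) : _)

theorem su2M_mul (g h : SU2) : su2M (g * h) = su2M g * su2M h := rfl

theorem su2M_one : su2M 1 = 1 := rfl

theorem su2M_inv (g : SU2) : su2M g⁻¹ = star (su2M g) := rfl

theorem su2M_mul_star (g : SU2) : su2M g * star (su2M g) = 1 :=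
  (Matrix.mem_unitaryGroup_iff).1 (g : Matrix.unitaryGroup (Fin 2) ℂ).2

theorem su2M_det (g : SU2) : (su2M g).det = 1 := g.2

theorem su2M_star (g : SU2) : star (su2M g) = (su2M g).adjugate := by
  have h1 := su2M_mul_star g
  have h2 : (su2M g).adjugate * su2M g = 1 := by
    rw [Matrix.adjugate_mul, su2M_det, one_smul]
  calc star (su2M g) = ((su2M g).adjugate * su2M g) * star (su2M g) := by rw [h2, one_mul]
    _ = _ := by rw [mul_assoc, h1, mul_one]

theorem su2M_11 (g : SU2) : su2M g 1 1 = star (su2M g 0 0) := by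
  have h := congrFun (congrFun (su2M_star g) 0) 0
  rw [Matrix.adjugate_fin_two] at h
  simpa using h.symm

theorem su2M_01 (g : SU2) : su2M g 0 1 = - star (su2M g 1 0) := by
  have h := congrFun (congrFun (su2M_star g) 0) 1
  rw [Matrix.adjugate_fin_two] at h
  simp [Matrix.star_apply] at h
  simp [h]

theorem su2M_norm (g : SU2) : (su2M g 0 0).re ^ 2 + (su2M g 0 0).im ^ 2
    + (su2M g 1 0).re ^ 2 + (su2M g 1 0).im ^ 2 = 1 := by
  have h := su2M_det g
  rw [Matrix.det_fin_two, su2M_11, su2M_01] at h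
  have h' := congrArg Complex.re h
  simp at h'
  nlinarith

/-- construct an element -/
noncomputable def su2mk (p q : ℂ) (h : p.re ^ 2 + p.im ^ 2 + q.re ^ 2 + q.im ^ 2 = 1) : SU2 :=
  ⟨⟨!![p, - star q; q, star p], by
    rw [Matrix.mem_unitaryGroup_iff]
    ext i j
    fin_cases i <;> fin_cases j <;>
      simp [Matrix.mul_apply, Fin.sum_univ_two, Matrix.star_apply, Complex.ext_iff] <;>
      (try constructor) <;> nlinarith⟩, by
    rw [mem_SU2_iff, Matrix.det_fin_two]
    simp [Complex.ext_iff]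
    constructor <;> nlinarith⟩

theorem su2mk_00 (p q : ℂ) (h) : su2M (su2mk p q h) 0 0 = p := rfl
theorem su2mk_10 (p q : ℂ) (h) : su2M (su2mk p q h) 1 0 = q := rfl

theorem su2_ext' {g h : SU2} (h0 : su2M g 0 0 = su2M h 0 0) (h1 : su2M g 1 0 = su2M h 1 0) :
    g = h := by
  apply su2_ext
  change su2M g = su2M h
  ext i j
  fin_cases i <;> fin_cases j
  · exact h0
  · simp [su2M_01, h1]
  · exact h1
  · simp [su2M_11, h0]

theorem su2_mul_00 (g h : SU2) : su2M (g * h) 0 0 =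
    su2M g 0 0 * su2M h 0 0 - star (su2M g 1 0) * su2M h 1 0 := by
  rw [su2M_mul, Matrix.mul_apply, Fin.sum_univ_two, su2M_01]; ring

theorem su2_mul_10 (g h : SU2) : su2M (g * h) 1 0 =
    su2M g 1 0 * su2M h 0 0 + star (su2M g 0 0) * su2M h 1 0 := by
  rw [su2M_mul, Matrix.mul_apply, Fin.sum_univ_two, su2M_11]

theorem su2_diag_00 (l : ℝ) : su2M (su2diag l) 0 0 = ⟨Real.cos l, Real.sin l⟩ := by
  have : su2M (su2diag l) 0 0 = Complex.exp (l * Complex.I) := by simp [su2M, su2diag]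
  rw [this]
  apply Complex.ext
  · simp [Complex.exp_ofReal_mul_I_re]
  · simp [Complex.exp_ofReal_mul_I_im]

theorem su2_diag_10 (l : ℝ) : su2M (su2diag l) 1 0 = 0 := by
  simp [su2M, su2diag]

theorem su2_inv_00 (g : SU2) : su2M g⁻¹ 0 0 = star (su2M g 0 0) := rfl

theorem su2_re_conj (h g : SU2) : (su2M (h * g * h⁻¹) 0 0).re = (su2M g 0 0).re := by
  have tr : ∀ g : SU2, (su2M g).trace = ((2 * (su2M g 0 0).re : ℝ) : ℂ) := by
    intro g
    rw [Matrix.trace_fin_two, su2M_11]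
    apply Complex.ext <;> simp; ring
  have h1 : (su2M (h * g * h⁻¹)).trace = (su2M g).trace := by
    rw [su2M_mul, Matrix.trace_mul_comm, ← su2M_mul]
    congr 2
    group
  rw [tr, tr] at h1
  have := Complex.ofReal_injective h1
  linarith

theorem conjClass_re {l : ℝ} {g : SU2} (hg : g ∈ conjClass l) : (su2M g 0 0).re = Real.cos l := by
  obtain ⟨h, rfl⟩ := hg
  rw [su2_re_conj, su2_diag_00]

theorem conjClass_conj {l : ℝ} {g : SU2} (k : SU2) (hg : g ∈ conjClass l) :
    k * g * k⁻¹ ∈ conjClass l := by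
  obtain ⟨h, rfl⟩ := hg
  exact ⟨k * h, by group⟩

theorem mem_conjClass_of_re {l : ℝ} (hl : l ∈ Set.Icc 0 Real.pi) {g : SU2}
    (hg : (su2M g 0 0).re = Real.cos l) : g ∈ conjClass l := by
  have hs : 0 ≤ Real.sin l := Real.sin_nonneg_of_mem_Icc hl
  have hn := su2M_norm g
  have hcs := Real.sin_sq_add_cos_sq l
  have hd0 := su2_diag_00 l
  have hd1 := su2_diag_10 l
  -- it suffices to solve g h = h d
  suffices H : ∃ h : SU2, h * su2diag l = g * h by
    obtain ⟨h, hh⟩ := H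
    exact ⟨h, by rw [hh]; group⟩
  generalize hp : su2M g 0 0 = p at *
  generalize hq : su2M g 1 0 = q at *
  set s := Real.sin l
  set c := Real.cos l
  obtain ⟨x, y⟩ := p
  obtain ⟨u, v⟩ := q
  simp only at hn hg
  subst hg
  have hn' : y ^ 2 + u ^ 2 + v ^ 2 = s ^ 2 := by linarith
  by_cases hy : s + y = 0
  · have hu : u = 0 := by nlinarith [sq_nonneg u, sq_nonneg v]
    have hv : v = 0 := by nlinarith [sq_nonneg u, sq_nonneg v]
    have hy' : y = -s := by linarith
    subst hu hv hy'
    refine ⟨su2mk 0 1 (by simp), su2_ext' ?_ ?_⟩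
    · rw [su2_mul_00, su2_mul_00, su2mk_00, su2mk_10, hp, hq, hd1]
      apply Complex.ext <;> simp
    · rw [su2_mul_10, su2_mul_10, su2mk_00, su2mk_10, hp, hq, hd0]
      apply Complex.ext <;> simp
  · have hpos : 0 < s + y := by
      have : -s ≤ y := by nlinarith [sq_nonneg u, sq_nonneg v]
      rcases lt_or_eq_of_le (show 0 ≤ s + y by linarith) with h | h
      · exact h
      · exact absurd h.symm hy
    set N := (s + y) ^ 2 + u ^ 2 + v ^ 2 with hN
    have hNpos : 0 < N := by positivity
    set r := (Real.sqrt N)⁻¹ with hr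
    have hr2 : r ^ 2 * N = 1 := by
      rw [hr, inv_pow, Real.sq_sqrt hNpos.le]; field_simp
    refine ⟨su2mk ⟨r * (s + y), 0⟩ ⟨r * v, - (r * u)⟩ ?_, su2_ext' ?_ ?_⟩
    · simp only; rw [← hr2, hN]; ring
    · rw [su2_mul_00, su2_mul_00, su2mk_00, su2mk_10, hp, hq, hd0, hd1]
      apply Complex.ext <;> simp
      · ring
      · linear_combination (-r) * hn'
    · rw [su2_mul_10, su2_mul_10, su2mk_00, su2mk_10, hp, hq, hd0, hd1]
      apply Complex.ext <;> simp <;> ring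

theorem su2_range {a b : ℝ} (ha : a ∈ Set.Icc 0 Real.pi) (hb : b ∈ Set.Icc 0 Real.pi) {g h : SU2}
    (hg : g ∈ conjClass a) (hh : h ∈ conjClass b) :
    Real.cos (a + b) ≤ (su2M (g * h) 0 0).re ∧ (su2M (g * h) 0 0).re ≤ Real.cos (a - b) := by
  have hg' := conjClass_re hg
  have hh' := conjClass_re hh
  have ng := su2M_norm g
  have nh := su2M_norm h
  have hsa : 0 ≤ Real.sin a := Real.sin_nonneg_of_mem_Icc ha
  have hsb : 0 ≤ Real.sin b := Real.sin_nonneg_of_mem_Icc hb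
  have ca := Real.sin_sq_add_cos_sq a
  have cb := Real.sin_sq_add_cos_sq b
  rw [su2_mul_00, Real.cos_add, Real.cos_sub]
  generalize su2M g 0 0 = p at *
  generalize su2M g 1 0 = q at *
  generalize su2M h 0 0 = p' at *
  generalize su2M h 1 0 = q' at *
  obtain ⟨x, y⟩ := p
  obtain ⟨u, v⟩ := q
  obtain ⟨x', y'⟩ := p'
  obtain ⟨u', v'⟩ := q'
  simp only at hg' hh' ng nh
  subst hg' hh'
  have e1 : y ^ 2 + u ^ 2 + v ^ 2 = Real.sin a ^ 2 := by linarith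
  have e2 : y' ^ 2 + u' ^ 2 + v' ^ 2 = Real.sin b ^ 2 := by linarith
  have key : |y * y' + u * u' + v * v'| ≤ Real.sin a * Real.sin b := by
    apply abs_le_of_sq_le_sq _ (by positivity)
    rw [mul_pow, ← e1, ← e2]
    nlinarith [sq_nonneg (y * u' - u * y'), sq_nonneg (y * v' - v * y'),
      sq_nonneg (u * v' - v * u')]
  rw [abs_le] at key
  simp
  constructor <;> linarith [key.1, key.2]

theorem su2_exists {a b t : ℝ} (ha : a ∈ Set.Icc 0 Real.pi) (hb : b ∈ Set.Icc 0 Real.pi)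
    (h1 : Real.cos (a + b) ≤ t) (h2 : t ≤ Real.cos (a - b)) :
    ∃ g ∈ conjClass a, ∃ h ∈ conjClass b, (su2M (g * h) 0 0).re = t := by
  have hsa : 0 ≤ Real.sin a := Real.sin_nonneg_of_mem_Icc ha
  have hsb : 0 ≤ Real.sin b := Real.sin_nonneg_of_mem_Icc hb
  have cb := Real.sin_sq_add_cos_sq b
  rw [Real.cos_add] at h1
  rw [Real.cos_sub] at h2
  have hy : ∃ y : ℝ, y ^ 2 ≤ Real.sin b ^ 2 ∧ Real.cos a * Real.cos b - Real.sin a * y = t := by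
    rcases hsa.eq_or_lt with h | h
    · refine ⟨0, by nlinarith [sq_nonneg (Real.sin b)], ?_⟩
      rw [← h] at h1 h2 ⊢
      linarith
    · refine ⟨(Real.cos a * Real.cos b - t) / Real.sin a, ?_, by field_simp; ring⟩
      apply sq_le_sq'
      · rw [le_div_iff₀ h]; linarith
      · rw [div_le_iff₀ h]; linarith
  obtain ⟨y, hy1, hy2⟩ := hy
  have hq := Real.sq_sqrt (sub_nonneg.2 hy1)
  refine ⟨su2diag a, ⟨1, by group⟩, su2mk ⟨Real.cos b, y⟩
    ⟨Real.sqrt (Real.sin b ^ 2 - y ^ 2), 0⟩ (by simp only; linarith), ?_, ?_⟩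
  · apply mem_conjClass_of_re hb
    rw [su2mk_00]
  · rw [su2_mul_00, su2_diag_00, su2_diag_10, su2mk_00]
    simpa using hy2

theorem cos_le_cos_sub_iff {a b c d : ℝ} (ha : a ∈ Set.Icc 0 Real.pi) (hb : b ∈ Set.Icc 0 Real.pi)
    (hc : c ∈ Set.Icc 0 Real.pi) (hd : d ∈ Set.Icc 0 Real.pi) :
    Real.cos (a + b) ≤ Real.cos (c - d) ↔
      (c - d ≤ a + b ∧ d - c ≤ a + b) ∧ (a + b + c - d ≤ 2 * Real.pi ∧
        a + b - c + d ≤ 2 * Real.pi) := by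
  obtain ⟨ha0, ha1⟩ := ha
  obtain ⟨hb0, hb1⟩ := hb
  obtain ⟨hc0, hc1⟩ := hc
  obtain ⟨hd0, hd1⟩ := hd
  rw [← Real.cos_abs (c - d)]
  have m : |c - d| ∈ Set.Icc 0 Real.pi :=
    ⟨abs_nonneg _, abs_le.2 ⟨by linarith, by linarith⟩⟩
  rcases le_total (a + b) Real.pi with h | h
  · rw [Real.strictAntiOn_cos.le_iff_ge ⟨by linarith, h⟩ m, abs_le]
    constructor
    · rintro ⟨h1, h2⟩
      refine ⟨⟨?_, ?_⟩, ?_, ?_⟩ <;> linarith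
    · rintro ⟨⟨h1, h2⟩, -⟩
      constructor <;> linarith
  · rw [← Real.cos_two_pi_sub (a + b),
      Real.strictAntiOn_cos.le_iff_ge ⟨by linarith, by linarith⟩ m, abs_le]
    constructor
    · rintro ⟨h1, h2⟩
      refine ⟨⟨?_, ?_⟩, ?_, ?_⟩ <;> linarith
    · rintro ⟨-, h1, h2⟩
      constructor <;> linarith

/-- For `λ₁, λ₂, λ₃, λ₄ ∈ [0, π]`, the identity belongs to
`C(λ₁)C(λ₂)C(λ₃)C(λ₄)` iff every signed sum `±λ₁ ± λ₂ ± λ₃ ± λ₄` with exactly one minus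
sign is `≤ 2π` and every such sum with exactly three minus signs is `≤ 0`. -/
theorem one_mem_four_classProd_iff (l₁ l₂ l₃ l₄ : ℝ)
    (h₁ : l₁ ∈ Set.Icc 0 Real.pi) (h₂ : l₂ ∈ Set.Icc 0 Real.pi)
    (h₃ : l₃ ∈ Set.Icc 0 Real.pi) (h₄ : l₄ ∈ Set.Icc 0 Real.pi) :
    (1 : SU2) ∈ conjClass l₁ * conjClass l₂ * conjClass l₃ * conjClass l₄ ↔
      (-l₁ + l₂ + l₃ + l₄ ≤ 2 * Real.pi ∧ l₁ - l₂ + l₃ + l₄ ≤ 2 * Real.pi ∧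
        l₁ + l₂ - l₃ + l₄ ≤ 2 * Real.pi ∧ l₁ + l₂ + l₃ - l₄ ≤ 2 * Real.pi) ∧
      (l₁ - l₂ - l₃ - l₄ ≤ 0 ∧ -l₁ + l₂ - l₃ - l₄ ≤ 0 ∧
        -l₁ - l₂ + l₃ - l₄ ≤ 0 ∧ -l₁ - l₂ - l₃ + l₄ ≤ 0) := by
  have key : (1 : SU2) ∈ conjClass l₁ * conjClass l₂ * conjClass l₃ * conjClass l₄ ↔
      Real.cos (l₁ + l₂) ≤ Real.cos (l₃ - l₄) ∧ Real.cos (l₃ + l₄) ≤ Real.cos (l₁ - l₂) := by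
    constructor
    · intro h
      obtain ⟨g, hg, g4, hg4, e⟩ := Set.mem_mul.1 h
      obtain ⟨g', hg', g3, hg3, rfl⟩ := Set.mem_mul.1 hg
      obtain ⟨g1, hg1, g2, hg2, rfl⟩ := Set.mem_mul.1 hg'
      have r1 := su2_range h₁ h₂ hg1 hg2
      have r2 := su2_range h₃ h₄ hg3 hg4
      have e' : g3 * g4 = (g1 * g2)⁻¹ := by
        apply eq_inv_of_mul_eq_one_right
        rw [← e]; group
      have e2 : (su2M (g3 * g4) 0 0).re = (su2M (g1 * g2) 0 0).re := by
        rw [e', su2_inv_00]; simp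
      constructor <;> linarith [r1.1, r1.2, r2.1, r2.2]
    · rintro ⟨k1, k2⟩
      have s1 : Real.cos (l₁ + l₂) ≤ Real.cos (l₁ - l₂) := by
        rw [Real.cos_add, Real.cos_sub]
        nlinarith [mul_nonneg (Real.sin_nonneg_of_mem_Icc h₁) (Real.sin_nonneg_of_mem_Icc h₂)]
      have s2 : Real.cos (l₃ + l₄) ≤ Real.cos (l₃ - l₄) := by
        rw [Real.cos_add, Real.cos_sub]
        nlinarith [mul_nonneg (Real.sin_nonneg_of_mem_Icc h₃) (Real.sin_nonneg_of_mem_Icc h₄)]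
      obtain ⟨t, t1, t2, t3, t4⟩ : ∃ t : ℝ, Real.cos (l₁ + l₂) ≤ t ∧ Real.cos (l₃ + l₄) ≤ t ∧
          t ≤ Real.cos (l₁ - l₂) ∧ t ≤ Real.cos (l₃ - l₄) :=
        ⟨max (Real.cos (l₁ + l₂)) (Real.cos (l₃ + l₄)), le_max_left _ _, le_max_right _ _,
          max_le s1 k2, max_le k1 s2⟩
      obtain ⟨g1, hg1, g2, hg2, e12⟩ := su2_exists h₁ h₂ t1 t3
      obtain ⟨g3, hg3, g4, hg4, e34⟩ := su2_exists h₃ h₄ t2 t4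
      have ht : Real.cos (Real.arccos t) = t :=
        Real.cos_arccos (le_trans (Real.neg_one_le_cos _) t1) (t3.trans (Real.cos_le_one _))
      have hm : Real.arccos t ∈ Set.Icc 0 Real.pi := ⟨Real.arccos_nonneg t, Real.arccos_le_pi t⟩
      obtain ⟨h, hh⟩ := mem_conjClass_of_re (g := g1 * g2) hm (by rw [e12, ht])
      obtain ⟨k, hk⟩ := mem_conjClass_of_re (g := (g3 * g4)⁻¹) hm
        (by rw [su2_inv_00, ht, ← e34]; simp)
      have hk' : g3 * g4 = k * (su2diag (Real.arccos t))⁻¹ * k⁻¹ := by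
        rw [← inv_inv (g3 * g4), ← hk]; group
      refine Set.mem_mul.2 ⟨g1 * g2 * ((h * k⁻¹) * g3 * (h * k⁻¹)⁻¹),
        Set.mul_mem_mul (Set.mul_mem_mul hg1 hg2) (conjClass_conj _ hg3),
        (h * k⁻¹) * g4 * (h * k⁻¹)⁻¹, conjClass_conj _ hg4, ?_⟩
      have : g1 * g2 * ((h * k⁻¹) * g3 * (h * k⁻¹)⁻¹) * ((h * k⁻¹) * g4 * (h * k⁻¹)⁻¹)
          = (g1 * g2) * ((h * k⁻¹) * (g3 * g4) * (h * k⁻¹)⁻¹) := by group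
      rw [this, hk', ← hh]; group
  rw [key, cos_le_cos_sub_iff h₁ h₂ h₃ h₄, cos_le_cos_sub_iff h₃ h₄ h₁ h₂]
  constructor
  · rintro ⟨⟨⟨a1, a2⟩, a3, a4⟩, ⟨⟨a5, a6⟩, a7, a8⟩⟩
    refine ⟨⟨?_, ?_, ?_, ?_⟩, ?_, ?_, ?_, ?_⟩ <;> linarith
  · rintro ⟨⟨a1, a2, a3, a4⟩, a5, a6, a7, a8⟩
    refine ⟨⟨⟨?_, ?_⟩, ?_, ?_⟩, ⟨⟨?_, ?_⟩, ?_, ?_⟩⟩ <;> linarith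
end

section
/- Let λ₁, λ₂, λ₃ ∈ [0, π]. The set product C(λ₁)C(λ₂)C(λ₃) equals all of SU(2) if and only if π ≤ λ₁ + λ₂ + λ₃ ≤ 2π and each of the three sums obtained from λ₁ + λ₂ + λ₃ by changing exactly one sign to minus lies in the interval [0, π]. -/
open Matrix Complex Pointwise

noncomputable def suMk (a b : ℂ) (h : normSq a + normSq b = 1) : SU2 :=
  ⟨⟨!![a, -(starRingEnd ℂ b); b, starRingEnd ℂ a], by
    have h' : a * starRingEnd ℂ a + b * starRingEnd ℂ b = 1 := by
      rw [mul_conj, mul_conj]; exact_mod_cast h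
    rw [Matrix.mem_unitaryGroup_iff, Matrix.star_eq_conjTranspose]
    ext i j
    fin_cases i <;> fin_cases j <;> simp [Matrix.mul_apply, Fin.sum_univ_two] <;>
      first | linear_combination h' | ring⟩, by
    have h' : a * starRingEnd ℂ a + b * starRingEnd ℂ b = 1 := by
      rw [mul_conj, mul_conj]; exact_mod_cast h
    rw [mem_SU2_iff]
    simp [Matrix.det_fin_two]
    linear_combination h'⟩

noncomputable def mat (g : SU2) : Matrix (Fin 2) (Fin 2) ℂ := g.1.1

theorem mat_inj {g h : SU2} (e : mat g = mat h) : g = h := Subtype.ext (Subtype.ext e)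

theorem mat_mul (g h : SU2) : mat (g * h) = mat g * mat h := rfl

theorem mat_one : mat 1 = 1 := rfl

theorem mat_suMk (a b : ℂ) (h) : mat (suMk a b h) = !![a, -(starRingEnd ℂ b); b, starRingEnd ℂ a] := rfl

theorem mat_diag (l : ℝ) : mat (su2diag l) =
    Matrix.diagonal ![Complex.exp (l * Complex.I), Complex.exp (-(l * Complex.I))] := rfl

theorem exists_suMk (g : SU2) : ∃ a b h, g = suMk a b h := by
  have hd : (mat g).det = 1 := g.2
  have hu : star (mat g) * mat g = 1 := Matrix.mem_unitaryGroup_iff'.1 g.1.2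
  have ha : star (mat g) = (mat g).adjugate := by
    calc star (mat g) = star (mat g) * (mat g * (mat g).adjugate) := by
          rw [Matrix.mul_adjugate, hd]; simp
      _ = _ := by rw [← mul_assoc, hu, one_mul]
  have h11 := congrFun (congrFun ha 0) 0
  have h01 := congrFun (congrFun ha 1) 0
  rw [Matrix.adjugate_fin_two] at h11 h01
  simp [Matrix.star_eq_conjTranspose] at h11 h01
  have e01 : mat g 0 1 = -(starRingEnd ℂ (mat g 1 0)) := by
    have h2 := congrArg (starRingEnd ℂ) h01
    simpa using h2
  have hn : normSq (mat g 0 0) + normSq (mat g 1 0) = 1 := by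
    rw [Matrix.det_fin_two, e01, ← h11] at hd
    have : ((normSq (mat g 0 0) + normSq (mat g 1 0) : ℝ) : ℂ) = 1 := by
      push_cast
      rw [← mul_conj, ← mul_conj]
      linear_combination hd
    exact_mod_cast this
  refine ⟨mat g 0 0, mat g 1 0, hn, mat_inj ?_⟩
  rw [mat_suMk]
  ext i j
  fin_cases i <;> fin_cases j <;> simp [e01, h11]

theorem diag_eq (l : ℝ) : ∃ h, su2diag l = suMk (Complex.exp (l * Complex.I)) 0 h := by
  have hh : normSq (Complex.exp (l * Complex.I)) + normSq 0 = 1 := by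
    rw [normSq_eq_norm_sq, Complex.norm_exp_ofReal_mul_I]; simp
  refine ⟨hh, mat_inj ?_⟩
  rw [mat_suMk, mat_diag]
  ext i j
  fin_cases i <;> fin_cases j <;> simp [← Complex.exp_conj]

noncomputable def ht (g : SU2) : ℝ := (mat g).trace.re / 2

theorem ht_suMk (a b h) : ht (suMk a b h) = a.re := by
  simp [ht, mat_suMk, Matrix.trace_fin_two]

theorem ht_comm (g h : SU2) : ht (g * h) = ht (h * g) := by
  simp only [ht, mat_mul]; rw [Matrix.trace_mul_comm]

theorem ht_conj (g h : SU2) : ht (h * g * h⁻¹) = ht g := by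
  rw [ht_comm]; simp

theorem ht_diag (l : ℝ) : ht (su2diag l) = Real.cos l := by
  obtain ⟨h, e⟩ := diag_eq l
  rw [e, ht_suMk, Complex.exp_ofReal_mul_I_re]

theorem suMk_mul_00 (a b h c d k) : mat (suMk a b h * suMk c d k) 0 0 = a * c - (starRingEnd ℂ b) * d := by
  simp [mat_mul, mat_suMk, Matrix.mul_apply, Fin.sum_univ_two]; ring

theorem ht_eq (g : SU2) : ht g = (mat g 0 0).re := by
  obtain ⟨a, b, h, rfl⟩ := exists_suMk g
  rw [ht_suMk]; simp [mat_suMk]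

theorem ht_mul (a b h c d k) : ht (suMk a b h * suMk c d k) = (a * c - (starRingEnd ℂ b) * d).re := by
  rw [ht_eq, suMk_mul_00]

theorem conj_of_eigen (a b h) (l : ℝ) (v w : ℂ) (hv : normSq v + normSq w ≠ 0)
    (h0 : a * v - starRingEnd ℂ b * w = Complex.exp (l * Complex.I) * v)
    (h1 : b * v + starRingEnd ℂ a * w = Complex.exp (l * Complex.I) * w) :
    suMk a b h ∈ conjClass l := by
  set N : ℝ := Real.sqrt (normSq v + normSq w) with hN
  have hp : 0 < normSq v + normSq w :=
    lt_of_le_of_ne (add_nonneg (normSq_nonneg _) (normSq_nonneg _)) hv.symm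
  have hN2 : N * N = normSq v + normSq w := Real.mul_self_sqrt hp.le
  have hN0 : N ≠ 0 := (Real.sqrt_pos.2 hp).ne'
  have hk : normSq (v / N) + normSq (w / N) = 1 := by
    rw [normSq_div, normSq_div, normSq_ofReal, hN2]; field_simp
  refine ⟨suMk (v / N) (w / N) hk, ?_⟩
  rw [mul_inv_eq_iff_eq_mul]
  apply mat_inj
  have h0' := congrArg (starRingEnd ℂ) h0
  have h1' := congrArg (starRingEnd ℂ) h1
  simp only [map_mul, map_add, map_sub, Complex.conj_conj, ← Complex.exp_conj, Complex.conj_ofReal, Complex.conj_I, mul_neg] at h0' h1'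
  have hNc : (N : ℂ) ≠ 0 := by exact_mod_cast hN0
  rw [mat_mul, mat_mul, mat_diag, mat_suMk, mat_suMk]
  ext i j
  fin_cases i <;> fin_cases j <;>
    simp [Matrix.mul_apply, Fin.sum_univ_two] <;> field_simp
  · linear_combination -h0
  · linear_combination h1'
  · linear_combination -h1
  · linear_combination -h0'

theorem mem_conjClass_iff (g : SU2) (l : ℝ) : g ∈ conjClass l ↔ ht g = Real.cos l := by
  constructor
  · rintro ⟨h, rfl⟩
    rw [ht_conj, ht_diag]
  · intro hg
    obtain ⟨a, b, h, rfl⟩ := exists_suMk g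
    rw [ht_suMk] at hg
    have hab : a * starRingEnd ℂ a + b * starRingEnd ℂ b = 1 := by
      rw [mul_conj, mul_conj]; exact_mod_cast h
    set e := Complex.exp (l * Complex.I) with he
    have hsum : a + starRingEnd ℂ a = e + starRingEnd ℂ e := by
      rw [add_conj, add_conj, hg, he, Complex.exp_ofReal_mul_I_re]
    have hee : e * starRingEnd ℂ e = 1 := by
      rw [mul_conj, normSq_eq_norm_sq, he, Complex.norm_exp_ofReal_mul_I]; simp
    by_cases hv : normSq (e - starRingEnd ℂ a) + normSq b = 0
    · have hb : b = 0 := by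
        rw [← normSq_eq_zero]
        nlinarith [normSq_nonneg b, normSq_nonneg (e - starRingEnd ℂ a)]
      have ha : e - starRingEnd ℂ a = 0 := by
        rw [← normSq_eq_zero]
        nlinarith [normSq_nonneg b, normSq_nonneg (e - starRingEnd ℂ a)]
      refine conj_of_eigen a b h l 0 1 (by simp) ?_ ?_
      · simp [hb]
      · rw [← he]; linear_combination -ha
    · refine conj_of_eigen a b h l (e - starRingEnd ℂ a) b hv ?_ ?_
      · rw [← he]
        linear_combination -hab + e * hsum + hee
      · rw [← he]; ring

theorem conj_closed {g : SU2} {l : ℝ} (h : SU2) (hg : g ∈ conjClass l) :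
    h * g * h⁻¹ ∈ conjClass l := by
  rw [mem_conjClass_iff] at *; rw [ht_conj, hg]

theorem subset_mul (a b n : ℝ) (h1 : Real.cos (a + b) ≤ Real.cos n)
    (h2 : Real.cos n ≤ Real.cos (a - b)) : conjClass n ⊆ conjClass a * conjClass b := by
  obtain ⟨t, -, ht'⟩ : Real.cos n ∈ (fun t : ℝ => Real.cos a * Real.cos b
      - (Real.cos t ^ 2 - Real.sin t ^ 2) * (Real.sin a * Real.sin b)) '' Set.Icc 0 (Real.pi / 2) := by
    apply intermediate_value_Icc (by positivity)
    · fun_prop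
    · constructor
      · simpa [Real.cos_add] using h1
      · simpa [Real.cos_sub] using h2
  have hk : normSq (Real.cos t : ℂ) + normSq (Real.sin t : ℂ) = 1 := by
    rw [normSq_ofReal, normSq_ofReal]; nlinarith [Real.sin_sq_add_cos_sq t]
  set k := suMk _ _ hk with hkd
  have hy : k * su2diag b * k⁻¹ ∈ conjClass b := ⟨k, rfl⟩
  have hx : su2diag a ∈ conjClass a := ⟨1, by simp⟩
  have hp : ht (su2diag a * (k * su2diag b * k⁻¹)) = Real.cos n := by
    have hki : k⁻¹ = suMk (Real.cos t : ℂ) (-(Real.sin t : ℂ)) (by rw [normSq_neg]; exact hk) := by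
      rw [inv_eq_iff_mul_eq_one]
      apply mat_inj
      rw [mat_mul, hkd, mat_suMk, mat_suMk, mat_one]
      have := Complex.sin_sq_add_cos_sq t
      ext i j
      fin_cases i <;> fin_cases j <;>
        simp [Matrix.mul_apply, Fin.sum_univ_two, ← Complex.cos_conj, ← Complex.sin_conj] <;>
        first | linear_combination this | ring
    rw [hki, ht_eq, mat_mul, mat_mul, mat_mul, hkd, mat_suMk, mat_suMk, mat_diag, mat_diag, ← ht']
    simp only [← neg_mul, ← Complex.ofReal_neg]
    simp [Matrix.mul_apply, Matrix.vecMul, dotProduct, Fin.sum_univ_two, -Complex.ofReal_neg, -Complex.ofReal_cos, -Complex.ofReal_sin,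
      Complex.exp_ofReal_mul_I_re, Complex.exp_ofReal_mul_I_im]
    linear_combination (Real.cos a * Real.cos b) * Real.sin_sq_add_cos_sq t
  intro g hg
  rw [← mem_conjClass_iff] at hp
  obtain ⟨u, hu⟩ := hg
  obtain ⟨v, hv⟩ := hp
  refine ⟨_, conj_closed (u * v⁻¹) hx, _, conj_closed (u * v⁻¹) hy, ?_⟩
  have : su2diag n = v⁻¹ * (su2diag a * (k * su2diag b * k⁻¹)) * v := by
    rw [← hv]; group
  rw [← hu, this]
  simp only
  group

theorem mul_bounds (a b : ℝ) (ha : a ∈ Set.Icc 0 Real.pi) (hb : b ∈ Set.Icc 0 Real.pi) (x y : SU2)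
    (hx : x ∈ conjClass a) (hy : y ∈ conjClass b) :
    Real.cos (a + b) ≤ ht (x * y) ∧ ht (x * y) ≤ Real.cos (a - b) := by
  obtain ⟨u, rfl⟩ := hx
  have e : ht (u * su2diag a * u⁻¹ * y) = ht (su2diag a * (u⁻¹ * y * u)) := by
    rw [← ht_conj (su2diag a * (u⁻¹ * y * u)) u]; congr 1; group
  have hz : u⁻¹ * y * u ∈ conjClass b := by simpa using conj_closed u⁻¹ hy
  rw [e]
  generalize u⁻¹ * y * u = z at hz
  obtain ⟨c, d, h, rfl⟩ := exists_suMk z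
  rw [mem_conjClass_iff, ht_suMk] at hz
  obtain ⟨hd, e'⟩ := diag_eq a
  rw [e', ht_mul]
  simp [Complex.exp_ofReal_mul_I_re, Complex.exp_ofReal_mul_I_im, Real.cos_add, Real.cos_sub, hz]
  have hsa := Real.sin_nonneg_of_mem_Icc ha
  have hsb := Real.sin_nonneg_of_mem_Icc hb
  have hc : c.im ^ 2 ≤ Real.sin b ^ 2 := by
    have := normSq_nonneg d
    rw [normSq_apply c, hz] at h
    nlinarith [Real.sin_sq_add_cos_sq b]
  have := abs_le_of_sq_le_sq' hc hsb
  constructor <;> nlinarith [this.1, this.2]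

theorem cos_iff (a b n : ℝ) (ha : a ∈ Set.Icc 0 Real.pi) (hb : b ∈ Set.Icc 0 Real.pi)
    (hn : n ∈ Set.Icc 0 Real.pi) : (Real.cos (a + b) ≤ Real.cos n ∧ Real.cos n ≤ Real.cos (a - b)) ↔
    (a - b ≤ n ∧ b - a ≤ n ∧ n ≤ a + b ∧ n ≤ 2 * Real.pi - a - b) := by
  obtain ⟨ha0, ha1⟩ := ha
  obtain ⟨hb0, hb1⟩ := hb
  have hn' := hn
  obtain ⟨hn0, hn1⟩ := hn
  have h2 : Real.cos n ≤ Real.cos (a - b) ↔ (a - b ≤ n ∧ b - a ≤ n) := by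
    rw [← Real.cos_abs (a - b), Real.strictAntiOn_cos.le_iff_ge hn'
      ⟨abs_nonneg _, abs_le.2 ⟨by linarith, by linarith⟩⟩, abs_le]
    constructor <;> rintro ⟨h, h'⟩ <;> constructor <;> linarith
  have h1 : Real.cos (a + b) ≤ Real.cos n ↔ (n ≤ a + b ∧ n ≤ 2 * Real.pi - a - b) := by
    rcases le_total (a + b) Real.pi with h | h
    · rw [Real.strictAntiOn_cos.le_iff_ge ⟨by linarith, h⟩ hn']
      constructor
      · intro h; constructor <;> linarith
      · exact fun h => h.1
    · rw [← Real.cos_two_pi_sub, Real.strictAntiOn_cos.le_iff_ge ⟨by linarith, by linarith⟩ hn']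
      constructor
      · intro h; constructor <;> linarith
      · intro h; linarith
  rw [h1, h2]; tauto

theorem ht_inv (g : SU2) : ht g⁻¹ = ht g := by
  have : mat g⁻¹ = star (mat g) := rfl
  rw [ht_eq, ht_eq, this]; simp [Matrix.star_eq_conjTranspose]

theorem exists_angle (g : SU2) : ∃ n ∈ Set.Icc 0 Real.pi, g ∈ conjClass n := by
  obtain ⟨a, b, h, e⟩ := exists_suMk g
  have : a.re ^ 2 ≤ 1 ^ 2 := by
    rw [normSq_apply a] at h; nlinarith [normSq_nonneg b, mul_self_nonneg a.im]
  have := abs_le_of_sq_le_sq' this zero_le_one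
  refine ⟨Real.arccos a.re, ⟨Real.arccos_nonneg _, Real.arccos_le_pi _⟩, ?_⟩
  rw [mem_conjClass_iff, Real.cos_arccos this.1 this.2, e, ht_suMk]

/-- For `λ₁, λ₂, λ₃ ∈ [0, π]`, the set product `C(λ₁)C(λ₂)C(λ₃)` equals
all of `SU(2)` iff `π ≤ λ₁ + λ₂ + λ₃ ≤ 2π` and each of the sums obtained by changing
exactly one sign to minus lies in `[0, π]`. -/
theorem three_classProd_eq_univ_iff (l₁ l₂ l₃ : ℝ)
    (h₁ : l₁ ∈ Set.Icc 0 Real.pi) (h₂ : l₂ ∈ Set.Icc 0 Real.pi)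
    (h₃ : l₃ ∈ Set.Icc 0 Real.pi) :
    conjClass l₁ * conjClass l₂ * conjClass l₃ = Set.univ ↔
      (Real.pi ≤ l₁ + l₂ + l₃ ∧ l₁ + l₂ + l₃ ≤ 2 * Real.pi) ∧
      (-l₁ + l₂ + l₃ ∈ Set.Icc 0 Real.pi) ∧
      (l₁ - l₂ + l₃ ∈ Set.Icc 0 Real.pi) ∧
      (l₁ + l₂ - l₃ ∈ Set.Icc 0 Real.pi) := by
  obtain ⟨a0, a1⟩ := h₁
  obtain ⟨b0, b1⟩ := h₂
  obtain ⟨c0, c1⟩ := h₃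
  constructor
  · intro hu
    have key : ∀ n ∈ Set.Icc 0 Real.pi, ∀ s : SU2, (∀ z ∈ conjClass l₃, ht (s * z⁻¹) = Real.cos n) →
        (l₁ - l₂ ≤ n ∧ l₂ - l₁ ≤ n ∧ n ≤ l₁ + l₂ ∧ n ≤ 2 * Real.pi - l₁ - l₂) := by
      intro n hn s hs
      have hm : s ∈ conjClass l₁ * conjClass l₂ * conjClass l₃ := by rw [hu]; trivial
      obtain ⟨w, ⟨x, hx, y, hy, rfl⟩, z, hz, e⟩ := hm
      have e2 : x * y = s * z⁻¹ := eq_mul_inv_of_mul_eq e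
      have := mul_bounds l₁ l₂ ⟨a0, a1⟩ ⟨b0, b1⟩ x y hx hy
      rw [e2, hs z hz] at this
      exact (cos_iff l₁ l₂ n ⟨a0, a1⟩ ⟨b0, b1⟩ hn).1 this
    have k1 := key l₃ ⟨c0, c1⟩ 1 (by
      intro z hz
      rw [one_mul, ht_inv]; exact (mem_conjClass_iff _ _).1 hz)
    have k2 := key (Real.pi - l₃) ⟨by linarith, by linarith⟩ (suMk (-1) 0 (by simp)) (by
      intro z hz
      rw [mem_conjClass_iff, ← ht_inv] at hz
      rw [Real.cos_pi_sub, ← hz]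
      obtain ⟨a, b, h, e⟩ := exists_suMk z⁻¹
      rw [e, ht_mul, ht_suMk]; simp)
    obtain ⟨p1, p2, p3, p4⟩ := k1
    obtain ⟨q1, q2, q3, q4⟩ := k2
    refine ⟨⟨?_, ?_⟩, ⟨?_, ?_⟩, ⟨?_, ?_⟩, ⟨?_, ?_⟩⟩ <;> linarith
  · rintro ⟨⟨s1, s2⟩, ⟨t1, t2⟩, ⟨u1, u2⟩, ⟨v1, v2⟩⟩
    rw [Set.eq_univ_iff_forall]
    intro g
    obtain ⟨m, ⟨m0, m1⟩, hg⟩ := exists_angle g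
    obtain ⟨n, hn, r1, r2⟩ : ∃ n ∈ Set.Icc 0 Real.pi,
        (l₁ - l₂ ≤ n ∧ l₂ - l₁ ≤ n ∧ n ≤ l₁ + l₂ ∧ n ≤ 2 * Real.pi - l₁ - l₂) ∧
        (n - l₃ ≤ m ∧ l₃ - n ≤ m ∧ m ≤ n + l₃ ∧ m ≤ 2 * Real.pi - n - l₃) := by
      refine ⟨max (min l₃ (Real.pi - l₃)) (max (l₃ - m) (m - l₃)), ?_⟩
      simp only [Set.mem_Icc]
      rcases max_cases (min l₃ (Real.pi - l₃)) (max (l₃ - m) (m - l₃)) with ⟨e1, f1⟩ | ⟨e1, f1⟩ <;>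
      rcases min_cases l₃ (Real.pi - l₃) with ⟨e2, f2⟩ | ⟨e2, f2⟩ <;>
      rcases max_cases (l₃ - m) (m - l₃) with ⟨e3, f3⟩ | ⟨e3, f3⟩ <;>
      refine ⟨⟨?_, ?_⟩, ⟨?_, ?_, ?_, ?_⟩, ⟨?_, ?_, ?_, ?_⟩⟩ <;> linarith
    have i1 := (cos_iff l₁ l₂ n ⟨a0, a1⟩ ⟨b0, b1⟩ hn).2 r1
    have i2 := (cos_iff n l₃ m hn ⟨c0, c1⟩ ⟨m0, m1⟩).2 r2
    exact Set.mul_subset_mul_right (subset_mul _ _ _ i1.1 i1.2) (subset_mul _ _ _ i2.1 i2.2 hg)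
end
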